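/- Let m ≥ 1, x_1,…,x_m ∈ ℝ, y ∈ ℝ, h ∈ ℝ, let H be the (2m+1)×(2m+1) tridiagonal matrix with diagonal (x_m,…,x_1, y, x_1,…,x_m) and constant off-diagonal h, and let B₊ ∈ ℝ^{(m+1)×(m+1)} be the matrix whose top-left m×m block is the tridiagonal matrix with diagonal (x_m,…,x_1) and constant off-diagonal h, whose (m+1,m+1) entry is y, and whose (m,m+1) and (m+1,m) entries equal √2·h. Then for every eigenvalue μ of B₊ there exists a nonzero vector ψ ∈ ℝ^{2m+1} with Hψ = μψ that has positive parity with respect to reflection through the central site, i.e., ψ_{2m+2−i} = ψ_i for all 1 ≤ i ≤ 2m+1. -/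

import Mathlib

/-- The `n × n` real symmetric tridiagonal matrix with diagonal entries `v 0, …, v (n-1)`
and all sub- and superdiagonal entries equal to the constant hopping `h`. -/
def tridiag (n : ℕ) (v : Fin n → ℝ) (h : ℝ) : Matrix (Fin n) (Fin n) ℝ :=
  Matrix.of fun i j =>
    if i = j then v i else if i.val + 1 = j.val ∨ j.val + 1 = i.val then h else 0

/-- The reflection-symmetric word `X⁻¹ Y X` of length `2m+1`: the on-site potentials
`(x_m, …, x_1, y, x_1, …, x_m)` (here `x` is 0-based, so `x_k` above is `x (k-1)`). -/
def symWord (m : ℕ) (x : Fin m → ℝ) (y : ℝ) : Fin (2 * m + 1) → ℝ := fun i =>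
  if h1 : i.val < m then x ⟨m - 1 - i.val, by omega⟩
  else if h2 : i.val = m then y
  else x ⟨i.val - m - 1, by have := i.isLt; omega⟩

/-- The `(m+1) × (m+1)` matrix `B₊`: its top-left `m × m` block is the tridiagonal
matrix with diagonal `(x_m, …, x_1)` and constant off-diagonal `h`, its `(m+1,m+1)`
entry is `y`, its `(m,m+1)` and `(m+1,m)` entries are `√2·h`, and all other entries
vanish (1-based description; indices here are 0-based). -/
noncomputable def Bplus (m : ℕ) (x : Fin m → ℝ) (y h : ℝ) :
    Matrix (Fin (m + 1)) (Fin (m + 1)) ℝ :=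
  Matrix.of fun i j =>
    if i = j then (if hi : i.val < m then x ⟨m - 1 - i.val, by omega⟩ else y)
    else if i.val + 1 = j.val ∨ j.val + 1 = i.val then
      (if i.val = m ∨ j.val = m then Real.sqrt 2 * h else h)
    else 0

/-- A finite sum whose terms vanish away from `i` and its neighbours has at most three terms. -/
lemma sum_eq_of_tridiagonal {n : ℕ} (f : Fin n → ℝ) (i : Fin n)
    (hf : ∀ j : Fin n, j ≠ i → i.val + 1 ≠ j.val → j.val + 1 ≠ i.val → f j = 0) :
    ∑ j, f j = f i + (if h : i.val + 1 < n then f ⟨i.val + 1, h⟩ else 0) +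
      (if 0 < i.val then f ⟨i.val - 1, by have := i.isLt; omega⟩ else 0) := by
  have key : ∀ j, f j = (if j = i then f j else 0) + (if i.val + 1 = j.val then f j else 0) +
      (if j.val + 1 = i.val then f j else 0) := by
    intro j
    by_cases h1 : j = i
    · subst h1; simp
    · by_cases h2 : i.val + 1 = j.val
      · have h3 : j.val + 1 ≠ i.val := by omega
        simp [h1, h2, h3]
      · by_cases h3 : j.val + 1 = i.val
        · simp [h1, h2, h3]
        · simp [h1, h2, h3, hf j h1 h2 h3]
  rw [Finset.sum_congr rfl fun j _ => key j, Finset.sum_add_distrib, Finset.sum_add_distrib]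
  congr 1
  · congr 1
    · simp
    · split_ifs with h
      · rw [Finset.sum_eq_single ⟨i.val + 1, h⟩]
        · simp
        · intro j _ hj
          rw [if_neg]
          intro e
          exact hj (Fin.ext e.symm)
        · simp
      · refine Finset.sum_eq_zero fun j _ => if_neg ?_
        have := j.isLt
        omega
  · split_ifs with h
    · rw [Finset.sum_eq_single ⟨i.val - 1, by have := i.isLt; omega⟩]
      · rw [if_pos]
        show i.val - 1 + 1 = i.val
        omega
      · intro j _ hj
        rw [if_neg]
        intro e
        refine hj (Fin.ext ?_)
        show j.val = i.val - 1
        omega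
      · simp
    · exact Finset.sum_eq_zero fun j _ => if_neg (by omega)

/-- The `k`-th row of the product of `tridiag n v h` with a vector. -/
lemma tridiag_mulVec_apply (n : ℕ) (v : Fin n → ℝ) (h : ℝ) (q : ℕ → ℝ) (k : ℕ) (hk : k < n) :
    (tridiag n v h).mulVec (fun i => q i.val) ⟨k, hk⟩ =
      v ⟨k, hk⟩ * q k + (if k + 1 < n then h * q (k + 1) else 0) +
        (if 0 < k then h * q (k - 1) else 0) := by
  unfold Matrix.mulVec dotProduct
  rw [sum_eq_of_tridiagonal _ ⟨k, hk⟩]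
  · congr 1
    · congr 1
      · simp [tridiag]
      · by_cases hn : k + 1 < n <;> simp [tridiag, hn]
    · by_cases h0 : 0 < k
      · have h1 : k ≠ k - 1 := by omega
        have h2 : k - 1 + 1 = k := by omega
        simp [tridiag, h0, h1, h2]
      · simp [h0]
  · intro j h1 h2 h3
    simp only at h2 h3
    simp [tridiag, h1.symm, h2, h3]

/-- The `k`-th row of the product of `B₊` with a vector. -/
lemma Bplus_mulVec_apply (m : ℕ) (x : Fin m → ℝ) (y h : ℝ) (p : ℕ → ℝ) (k : ℕ)
    (hk : k < m + 1) :
    (Bplus m x y h).mulVec (fun i => p i.val) ⟨k, hk⟩ =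
      (if hi : k < m then x ⟨m - 1 - k, by omega⟩ else y) * p k +
        (if k < m then (if k + 1 = m then Real.sqrt 2 * h else h) * p (k + 1) else 0) +
        (if 0 < k then (if k = m then Real.sqrt 2 * h else h) * p (k - 1) else 0) := by
  unfold Matrix.mulVec dotProduct
  rw [sum_eq_of_tridiagonal _ ⟨k, hk⟩]
  · congr 1
    · congr 1
      · simp [Bplus]
      · by_cases hn : k < m
        · have h1 : k ≠ m := by omega
          simp [Bplus, hn, h1]
        · simp [hn]
    · by_cases h0 : 0 < k
      · have h1 : k ≠ k - 1 := by omega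
        have h2 : k - 1 + 1 = k := by omega
        have h3 : k - 1 ≠ m := by omega
        simp [Bplus, h0, h1, h2, h3]
      · simp [h0]
  · intro j h1 h2 h3
    simp only at h2 h3
    simp [Bplus, h1.symm, h2, h3]

/-- The even extension to `2 * m + 1` sites of a vector on `m + 1` sites, with the central
component scaled by `√2`. -/
noncomputable def evenExtension (m : ℕ) (p : ℕ → ℝ) (k : ℕ) : ℝ :=
  if k < m then p k else if k = m then Real.sqrt 2 * p m else p (2 * m - k)

lemma evenExtension_of_lt {m : ℕ} (p : ℕ → ℝ) {k : ℕ} (hk : k < m) :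
    evenExtension m p k = p k := if_pos hk

lemma evenExtension_self (m : ℕ) (p : ℕ → ℝ) :
    evenExtension m p m = Real.sqrt 2 * p m := by simp [evenExtension]

lemma evenExtension_of_gt {m : ℕ} (p : ℕ → ℝ) {k : ℕ} (hk : m < k) :
    evenExtension m p k = p (2 * m - k) := by
  simp [evenExtension, hk.not_gt, hk.ne']

lemma evenExtension_reflect {m : ℕ} (p : ℕ → ℝ) {k : ℕ} (hk : k ≤ 2 * m) :
    evenExtension m p (2 * m - k) = evenExtension m p k := by
  rcases lt_trichotomy k m with h | h | h
  · rw [evenExtension_of_lt p h, evenExtension_of_gt p (by omega)]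
    congr 1; omega
  · subst h
    congr 1; omega
  · rw [evenExtension_of_gt p h, evenExtension_of_lt p (by omega)]

lemma symWord_reflect {m : ℕ} (x : Fin m → ℝ) (y : ℝ) {k : ℕ} (hk : k < 2 * m + 1) :
    symWord m x y ⟨2 * m - k, by omega⟩ = symWord m x y ⟨k, hk⟩ := by
  rcases lt_trichotomy k m with h | h | h
  · have h1 : ¬ 2 * m - k < m := by omega
    have h2 : 2 * m - k ≠ m := by omega
    simp only [symWord, h, h1, h2, dif_pos, dif_neg, not_false_eq_true]
    congr 2; omega
  · subst h
    congr 2; omega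
  · have h1 : 2 * m - k < m := by omega
    have h2 : ¬ k < m := by omega
    have h3 : k ≠ m := by omega
    simp only [symWord, h1, h2, h3, dif_pos, dif_neg, not_false_eq_true]
    congr 2; omega

/-- For every eigenvalue `μ` of `B₊` there is a nonzero eigenvector
`ψ` of `H = [X⁻¹YX]` with `Hψ = μψ` which has positive parity with respect to the
reflection through the central site: `ψ_{2m+2−i} = ψ_i` for all `i` (1-based); in
0-based indexing, `ψ (2m − i) = ψ i` for all `i : Fin (2m+1)`. -/
theorem stmt6 (m : ℕ) (hm : 1 ≤ m) (x : Fin m → ℝ) (y h : ℝ) (μ : ℝ)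
    (hμ : ∃ ψ : Fin (m + 1) → ℝ, ψ ≠ 0 ∧ (Bplus m x y h).mulVec ψ = μ • ψ) :
    ∃ ψ : Fin (2 * m + 1) → ℝ, ψ ≠ 0 ∧
      (tridiag (2 * m + 1) (symWord m x y) h).mulVec ψ = μ • ψ ∧
      ∀ i : Fin (2 * m + 1),
        ψ ⟨2 * m - i.val, by have := i.isLt; omega⟩ = ψ i := by
  obtain ⟨φ, hφ, hB⟩ := hμ
  obtain ⟨p, rfl⟩ : ∃ p : ℕ → ℝ, φ = fun i => p i.val :=
    ⟨fun k => if hk : k < m + 1 then φ ⟨k, hk⟩ else 0, by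
      funext i
      have hi := i.isLt
      simp only [hi, dite_true]⟩
  have row : ∀ k (hk : k < m + 1), _ = μ * p k := fun k hk =>
    (Bplus_mulVec_apply m x y h p k hk).symm.trans (congrFun hB ⟨k, hk⟩)
  have left : ∀ k (hk : k < 2 * m + 1), k ≤ m →
      (tridiag (2 * m + 1) (symWord m x y) h).mulVec (fun i => evenExtension m p i.val) ⟨k, hk⟩ =
        μ * evenExtension m p k := by
    intro k hk hkm
    have hr := row k (by omega)
    rw [tridiag_mulVec_apply]
    rcases hkm.lt_or_eq with hlt | rfl
    · have e1 : (if 0 < k then h * evenExtension m p (k - 1) else 0) =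
          if 0 < k then h * p (k - 1) else 0 := by
        rw [evenExtension_of_lt p (by omega)]
      have e2 : h * evenExtension m p (k + 1) =
          (if k + 1 = m then Real.sqrt 2 * h else h) * p (k + 1) := by
        split_ifs with e
        · rw [e, evenExtension_self]; ring
        · rw [evenExtension_of_lt p (by omega)]
      rw [e1, e2, evenExtension_of_lt p hlt, if_pos (by omega), ← hr]
      simp [symWord, hlt, hlt.ne]
    · have hs : Real.sqrt 2 * Real.sqrt 2 = 2 := Real.mul_self_sqrt (by norm_num)
      have e3 : 2 * k - (k + 1) = k - 1 := by omega
      rw [evenExtension_self, evenExtension_of_gt p (Nat.lt_succ_self k),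
        evenExtension_of_lt p (by omega), if_pos (by omega), if_pos (by omega), Nat.succ_eq_add_one,
        e3]
      have hk0 : 0 < k := hm
      simp only [lt_irrefl, dite_false, if_false, if_true, hk0] at hr
      simp only [symWord, lt_irrefl, dite_false, dite_true]
      linear_combination Real.sqrt 2 * hr - h * p (k - 1) * hs
  refine ⟨fun i => evenExtension m p i.val, ?_, ?_, ?_⟩
  · intro h0
    apply hφ
    funext i
    have hi := congrFun h0 ⟨i.val, by have := i.isLt; omega⟩
    rcases (Nat.lt_succ_iff.mp i.isLt).lt_or_eq with hlt | heq
    · simpa [evenExtension_of_lt p hlt] using hi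
    · simpa [heq, evenExtension_self] using hi
  · funext ⟨k, hk⟩
    show _ = μ * evenExtension m p k
    rcases le_or_gt k m with hkm | hkm
    · exact left k hk hkm
    · have hr := left (2 * m - k) (by omega) (by omega)
      rw [tridiag_mulVec_apply, symWord_reflect x y hk, evenExtension_reflect p (by omega)] at hr
      rw [← hr, tridiag_mulVec_apply]
      have e1 : (if k + 1 < 2 * m + 1 then h * evenExtension m p (k + 1) else 0) =
          if 0 < 2 * m - k then h * evenExtension m p (2 * m - k - 1) else 0 := by
        by_cases hc : k + 1 < 2 * m + 1
        · rw [if_pos hc, if_pos (by omega), ← evenExtension_reflect p (by omega : k + 1 ≤ 2 * m)]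
          congr 2
        · rw [if_neg hc, if_neg (by omega)]
      have e2 : evenExtension m p (2 * m - k + 1) = evenExtension m p (k - 1) := by
        rw [← evenExtension_reflect p (by omega : k - 1 ≤ 2 * m)]
        congr 1; omega
      rw [e1, e2, if_pos (by omega : 0 < k), if_pos (by omega : 2 * m - k + 1 < 2 * m + 1)]
      ring
  · intro i
    exact evenExtension_reflect p (Nat.lt_succ_iff.mp i.isLt)
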